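/- Fix a positive integer n and a positive integer j. The map V restricts to a bijection from the set of compositions (c_1,…,c_t) of n satisfying c_{2i-1} > c_{2i} − (2j+1) for every index i with 2i ≤ t onto the set of compositions of n each of whose parts is either even or an odd number belonging to {1, 3, …, 2j+1}. -/

import Mathlib

/-- A composition of `n`: a list of positive integers summing to `n`. -/
def IsComposition (n : ℕ) (l : List ℕ) : Prop :=
  (∀ x ∈ l, 0 < x) ∧ l.sum = n

/-- The image of one pair `(x, y)` of parts under the map `V`:
if `y - x < 1` (i.e. `y ≤ x`) it becomes `(1^{x-y}, 2y)` with the part `2y`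
omitted when `y = 0`; otherwise, with the unique `k ≥ 1` such that
`2k-1 ≤ y-x < 2k+1` (namely `k = (y-x+1)/2`), it becomes
`(1^{x+y-2k-1}, 2k+1)`. -/
def Vstep (x y : ℕ) : List ℕ :=
  if y ≤ x then List.replicate (x - y) 1 ++ (if y = 0 then [] else [2 * y])
  else List.replicate (x + y - 2 * ((y - x + 1) / 2) - 1) 1 ++ [2 * ((y - x + 1) / 2) + 1]

/-- The map `V`: pair up consecutive parts (appending a final `0` when the
length is odd), apply `Vstep` to each pair, and concatenate. -/
def V : List ℕ → List ℕ
  | [] => []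
  | [x] => Vstep x 0
  | x :: y :: rest => Vstep x y ++ V rest

/-- Inverse of `V`; the first argument counts the parts equal to `1` read since the last
part larger than `1`. -/
def invV : ℕ → List ℕ → List ℕ
  | m, [] => if m = 0 then [] else [m]
  | m, a :: l =>
    if a = 1 then invV (m + 1) l
    else if a % 2 = 0 then (m + a / 2) :: (a / 2) :: invV 0 l
    else ((m + 2) / 2) :: (m + a - (m + 2) / 2) :: invV 0 l

theorem invV_replicate_append (k m : ℕ) (l : List ℕ) :
    invV m (List.replicate k 1 ++ l) = invV (m + k) l := by
  induction k generalizing m with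
  | zero => simp
  | succ k ih =>
    rw [List.replicate_succ, List.cons_append, invV, if_pos rfl, ih]
    congr 1
    omega

theorem Vstep_zero_right (x : ℕ) : Vstep x 0 = List.replicate x 1 := by
  simp [Vstep]

theorem invV_Vstep_append (x y : ℕ) (hx : 0 < x) (hy : 0 < y) (l : List ℕ) :
    invV 0 (Vstep x y ++ l) = x :: y :: invV 0 l := by
  unfold Vstep
  split_ifs with h h0
  · omega
  · rw [List.append_assoc, invV_replicate_append, List.singleton_append, invV,
      if_neg (by omega), if_pos (by omega)]
    congr 2 <;> omega
  · rw [List.append_assoc, invV_replicate_append, List.singleton_append, invV,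
      if_neg (by omega), if_neg (by omega)]
    congr 2 <;> omega

theorem invV_V : ∀ l : List ℕ, (∀ x ∈ l, 0 < x) → invV 0 (V l) = l
  | [], _ => by simp [V, invV]
  | [x], h => by
    have hx : 0 < x := h x (by simp)
    have := invV_replicate_append x 0 []
    rw [List.append_nil] at this
    rw [V, Vstep_zero_right, this, invV, if_neg (by omega), Nat.zero_add]
  | x :: y :: l, h => by
    rw [V, invV_Vstep_append x y (h x (by simp)) (h y (by simp)),
      invV_V l fun z hz => h z (by simp [hz])]

theorem V_invV (l : List ℕ) (hl : ∀ x ∈ l, 0 < x) (m : ℕ) :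
    V (invV m l) = List.replicate m 1 ++ l := by
  induction l generalizing m with
  | nil =>
    rw [invV]
    split_ifs with h
    · simp [V, h]
    · simp [V, Vstep_zero_right]
  | cons a l ih =>
    have ha : 0 < a := hl a (by simp)
    replace ih := ih fun z hz => hl z (by simp [hz])
    rw [invV]
    split_ifs with h1 h2
    · rw [ih, h1, List.replicate_succ', List.append_assoc, List.singleton_append]
    · rw [V, ih, Vstep, if_pos (by omega), if_neg (by omega), List.append_assoc]
      have e1 : m + a / 2 - a / 2 = m := by omega
      have e2 : 2 * (a / 2) = a := by omega
      simp [e1, e2]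
    · rw [V, ih, Vstep, if_neg (by omega), List.append_assoc]
      have e1 : 2 * ((m + a - (m + 2) / 2 - (m + 2) / 2 + 1) / 2) + 1 = a := by omega
      have e2 : (m + 2) / 2 + (m + a - (m + 2) / 2)
          - 2 * ((m + a - (m + 2) / 2 - (m + 2) / 2 + 1) / 2) - 1 = m := by omega
      rw [e1, e2]
      simp

theorem invV_pos (l : List ℕ) (hl : ∀ x ∈ l, 0 < x) (m : ℕ) : ∀ x ∈ invV m l, 0 < x := by
  induction l generalizing m with
  | nil =>
    rw [invV]
    split_ifs with h
    · simp
    · simpa using Nat.pos_of_ne_zero h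
  | cons a l ih =>
    have ha : 0 < a := hl a (by simp)
    replace ih := ih fun z hz => hl z (by simp [hz])
    rw [invV]
    split_ifs with h1 h2
    · exact ih _
    · simp only [List.forall_mem_cons]
      exact ⟨by omega, by omega, ih 0⟩
    · simp only [List.forall_mem_cons]
      exact ⟨by omega, by omega, ih 0⟩

theorem sum_Vstep (x y : ℕ) (hx : 0 < x) : (Vstep x y).sum = x + y := by
  unfold Vstep
  split_ifs with h h0 <;> simp <;> omega

theorem sum_V : ∀ l : List ℕ, (∀ x ∈ l, 0 < x) → (V l).sum = l.sum
  | [], _ => by simp [V]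
  | [x], _ => by simp [V, Vstep_zero_right]
  | x :: y :: l, h => by
    rw [V, List.sum_append, sum_Vstep x y (h x (by simp)),
      sum_V l fun z hz => h z (by simp [hz])]
    simp [add_assoc]

theorem Vstep_pos (x y : ℕ) : ∀ a ∈ Vstep x y, 0 < a := by
  intro a ha
  unfold Vstep at ha
  split_ifs at ha <;> simp [List.mem_replicate] at ha <;> omega

theorem V_pos : ∀ l : List ℕ, ∀ a ∈ V l, 0 < a
  | [] => by simp [V]
  | [x] => Vstep_pos x 0
  | x :: y :: l => by
    rw [V, List.forall_mem_append]
    exact ⟨Vstep_pos x y, V_pos l⟩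

theorem Vstep_restricted_iff (j x y : ℕ) :
    (∀ a ∈ Vstep x y, Even a ∨ (Odd a ∧ a ≤ 2 * j + 1)) ↔ y < x + (2 * j + 1) := by
  have hone : ∀ k, ∀ a ∈ List.replicate k 1, Even a ∨ (Odd a ∧ a ≤ 2 * j + 1) := by
    intro k a ha
    rw [List.eq_of_mem_replicate ha]
    exact Or.inr ⟨odd_one, by omega⟩
  unfold Vstep
  split_ifs with h h0
  · simp only [List.append_nil]
    exact ⟨fun _ => by omega, fun _ => hone _⟩
  · rw [List.forall_mem_append]
    exact ⟨fun _ => by omega, fun _ => ⟨hone _, by simp⟩⟩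
  · rw [List.forall_mem_append, List.forall_mem_singleton, Nat.even_iff, Nat.odd_iff]
    exact ⟨fun H => by have := H.2; omega, fun H => ⟨hone _, by omega⟩⟩

theorem V_restricted_iff (j : ℕ) : ∀ l : List ℕ,
    (∀ a ∈ V l, Even a ∨ (Odd a ∧ a ≤ 2 * j + 1)) ↔
      ∀ i : ℕ, 2 * i + 1 < l.length → l.getD (2 * i + 1) 0 < l.getD (2 * i) 0 + (2 * j + 1)
  | [] => by simp [V]
  | [x] => by
    rw [V, Vstep_restricted_iff]
    exact ⟨fun _ i hi => by simp at hi, fun _ => by omega⟩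
  | x :: y :: l => by
    rw [V, List.forall_mem_append, Vstep_restricted_iff, V_restricted_iff j l]
    constructor
    · rintro ⟨h0, h⟩ (_ | i) hi
      · simpa using h0
      · simpa [Nat.mul_succ] using h i (by simp at hi; omega)
    · refine fun h => ⟨by simpa using h 0 (by simp), fun i hi => ?_⟩
      simpa [Nat.mul_succ] using h (i + 1) (by simp; omega)

/-- `V` restricts to a bijection from the compositions of `n` with
`c_{2i-1} > c_{2i} - (2j+1)` for each pair onto the compositions of `n` whose
parts are all even or odd numbers in `{1, 3, …, 2j+1}`. -/
theorem V_bijOn_restricted (n j : ℕ) (hn : 0 < n) (hj : 0 < j) :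
    Set.BijOn V
      {l : List ℕ | IsComposition n l ∧
        ∀ i : ℕ, 2 * i + 1 < l.length →
          l.getD (2 * i + 1) 0 < l.getD (2 * i) 0 + (2 * j + 1)}
      {l : List ℕ | IsComposition n l ∧
        ∀ x ∈ l, Even x ∨ (Odd x ∧ x ≤ 2 * j + 1)} := by
  refine ⟨?_, ?_, ?_⟩
  · rintro l ⟨⟨hpos, hsum⟩, hl⟩
    exact ⟨⟨V_pos l, (sum_V l hpos).trans hsum⟩, (V_restricted_iff j l).2 hl⟩
  · rintro l ⟨⟨hl, _⟩, _⟩ l' ⟨⟨hl', _⟩, _⟩ h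
    rw [← invV_V l hl, h, invV_V l' hl']
  · rintro l ⟨⟨hpos, hsum⟩, hl⟩
    have hV : V (invV 0 l) = l := by simpa using V_invV l hpos 0
    have hinv := invV_pos l hpos 0
    refine ⟨invV 0 l, ⟨⟨hinv, ?_⟩, (V_restricted_iff j _).1 (hV.symm ▸ hl)⟩, hV⟩
    rw [← sum_V _ hinv, hV, hsum]
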